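/- arXiv:1408.0597 — 2 statements merged into one kernel-verified Lean document; each statement's English description precedes it below -/
import Mathlib

section
/- Let σ be a nontrivial mean, i.e. a mean that is neither the left-trivial mean (A,B) ↦ A nor the right-trivial mean (A,B) ↦ B, with representing function f. Then for each A ≥ 0, if I σ A = A then A is an orthogonal projection. Consequently, the following are equivalent: (1) σ is nonregular (f(0) = 0); (2) for each A ≥ 0, A is an orthogonal projection if and only if I σ A = A. -/
open ContinuousLinearMap Filter Topology MeasureTheory
open scoped NNReal ENNReal

set_option synthInstance.maxHeartbeats 1000000
set_option maxHeartbeats 1000000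

noncomputable section

variable {H : Type} [NormedAddCommGroup H] [InnerProductSpace ℂ H] [CompleteSpace H]

/-- Convergence of a sequence of bounded operators in the strong operator topology. -/
def SOTTendsto (A : ℕ → H →L[ℂ] H) (A₀ : H →L[ℂ] H) : Prop :=
  ∀ x : H, Tendsto (fun n => A n x) atTop (𝓝 (A₀ x))

/-- A Kubo–Ando operator connection on the positive bounded operators on `H`:
a binary operation on positive operators (hence positivity of the output) satisfying
monotonicity (M1), the transformer inequality (M2) and continuity from above (M3). -/
structure IsConnection (σ : (H →L[ℂ] H) → (H →L[ℂ] H) → (H →L[ℂ] H)) : Prop where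
  isPositive : ∀ A B : H →L[ℂ] H, A.IsPositive → B.IsPositive → (σ A B).IsPositive
  mono : ∀ A B C D : H →L[ℂ] H, A.IsPositive → B.IsPositive → C.IsPositive → D.IsPositive →
    A ≤ C → B ≤ D → σ A B ≤ σ C D
  transformer : ∀ A B C : H →L[ℂ] H, A.IsPositive → B.IsPositive → C.IsPositive →
    C * σ A B * C ≤ σ (C * A * C) (C * B * C)
  contFromAbove : ∀ (A B : ℕ → H →L[ℂ] H) (A₀ B₀ : H →L[ℂ] H),
    (∀ n, (A n).IsPositive) → (∀ n, (B n).IsPositive) → A₀.IsPositive → B₀.IsPositive →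
    Antitone A → Antitone B → SOTTendsto A A₀ → SOTTendsto B B₀ →
    Antitone (fun n => σ (A n) (B n)) ∧ SOTTendsto (fun n => σ (A n) (B n)) (σ A₀ B₀)

/-- A function `f : [0,∞) → [0,∞)` is operator monotone if for every complex Hilbert
space `K` and all positive bounded operators `A ≤ B` on `K` one has `f(A) ≤ f(B)`,
where `f` is applied via the continuous functional calculus. -/
def OperatorMonotone (f : ℝ≥0 → ℝ≥0) : Prop :=
  ∀ (K : Type) [NormedAddCommGroup K] [InnerProductSpace ℂ K] [CompleteSpace K],
    ∀ A B : K →L[ℂ] K, A.IsPositive → B.IsPositive → A ≤ B → cfc f A ≤ cfc f B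

/-- `f` is the representing function of the connection `σ`: `f` is operator monotone
and `f(x)·I = I σ (x·I)` for all `x ≥ 0`. -/
def IsRepresentingFunction (σ : (H →L[ℂ] H) → (H →L[ℂ] H) → (H →L[ℂ] H))
    (f : ℝ≥0 → ℝ≥0) : Prop :=
  OperatorMonotone f ∧
    ∀ x : ℝ≥0, σ 1 ((x : ℝ) • (1 : H →L[ℂ] H)) = (f x : ℝ) • (1 : H →L[ℂ] H)

/-- The kernel `t ↦ 1 !ₜ x = x / ((1-t)x + t)`, with the conventions
`1 !₀ x = 1` for every `x` (in particular `1 !₀ 0 = 1`) and `1 !ₜ 0 = 0` for `t > 0`. -/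
def harmKernel (t : ℝ) (x : ℝ≥0) : ℝ≥0∞ :=
  if t = 0 then 1 else ENNReal.ofReal ((x : ℝ) / ((1 - t) * (x : ℝ) + t))

/-- `μ` is the associated (finite Borel) measure of a connection with representing
function `f`: `μ` is supported on `[0,1]` and `f(x) = ∫_{[0,1]} (1 !ₜ x) dμ(t)`. -/
def IsAssociatedMeasure (f : ℝ≥0 → ℝ≥0) (μ : Measure ℝ) : Prop :=
  μ (Set.Icc (0:ℝ) 1)ᶜ = 0 ∧
    ∀ x : ℝ≥0, (f x : ℝ≥0∞) = ∫⁻ t in Set.Icc (0:ℝ) 1, harmKernel t x ∂μ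

/-- `g` is the transpose of `f`: `g(x) = x·f(1/x)` for `x > 0`, extended to `0` by
continuity, i.e. `g(0) = lim_{x→0⁺} x·f(1/x)`. -/
def IsTransposeFunction (g f : ℝ≥0 → ℝ≥0) : Prop :=
  (∀ x : ℝ≥0, x ≠ 0 → g x = x * f x⁻¹) ∧
    Tendsto (fun x : ℝ≥0 => x * f x⁻¹) (𝓝[>] (0 : ℝ≥0)) (𝓝 (g 0))

section OrderLemmas

theorem le_of_forall_pos_le_add_smul {S T X : H →L[ℂ] H}
    (h : ∀ ε : ℝ, 0 < ε → S ≤ T + ε • X) : S ≤ T := by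
  have ht : Tendsto (fun ε : ℝ => T + ε • X) (𝓝[>] 0) (𝓝 (T + (0 : ℝ) • X)) :=
    ((continuous_const.add (continuous_id.smul continuous_const)).tendsto 0).mono_left
      nhdsWithin_le_nhds
  rw [zero_smul, add_zero] at ht
  exact ge_of_tendsto ht (eventually_nhdsWithin_of_forall fun ε hε => h ε hε)

open scoped ComplexOrder in
theorem SOTTendsto.ge {A : ℕ → H →L[ℂ] H} {A₀ B : H →L[ℂ] H} (hA : SOTTendsto A A₀)
    (h : ∀ n, B ≤ A n) : B ≤ A₀ := by
  rw [← sub_nonneg, ContinuousLinearMap.nonneg_iff_isPositive,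
    ContinuousLinearMap.isPositive_iff_complex]
  intro x
  have ht : Tendsto (fun n => inner ℂ ((A n - B) x) x) atTop (𝓝 (inner ℂ ((A₀ - B) x) x)) := by
    simp only [sub_apply]
    exact ((hA x).sub tendsto_const_nhds).inner tendsto_const_nhds
  have hp : ∀ n, 0 ≤ inner ℂ ((A n - B) x) x := fun n =>
    ((ContinuousLinearMap.nonneg_iff_isPositive _).1 (sub_nonneg.2 (h n))).inner_nonneg_left x
  have h0 : 0 ≤ inner ℂ ((A₀ - B) x) x := ge_of_tendsto' ht hp
  rw [RCLike.nonneg_iff] at h0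
  refine ⟨?_, h0.1⟩
  apply Complex.ext <;> simp
  exact h0.2.symm

theorem smul_one_le_smul_one_iff [Nontrivial H] {a b : ℝ} :
    a • (1 : H →L[ℂ] H) ≤ b • (1 : H →L[ℂ] H) ↔ a ≤ b := by
  rw [← Algebra.algebraMap_eq_smul_one, ← Algebra.algebraMap_eq_smul_one]
  exact algebraMap_le_algebraMap

theorem exists_pos_le_smul_one {A : H →L[ℂ] H} (hA : 0 ≤ A) :
    ∃ M : ℝ, 0 < M ∧ A ≤ M • (1 : H →L[ℂ] H) := by
  refine ⟨‖A‖ + 1, by positivity, ?_⟩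
  have h := IsSelfAdjoint.le_algebraMap_norm_self (a := A) (IsSelfAdjoint.of_nonneg hA)
  rw [Algebra.algebraMap_eq_smul_one] at h
  exact h.trans (smul_le_smul_of_nonneg_right (by linarith) zero_le_one)

theorem isStrictlyPositive_add_smul_one {A : H →L[ℂ] H} (hA : 0 ≤ A) {ε : ℝ} (hε : 0 < ε) :
    IsStrictlyPositive (A + ε • (1 : H →L[ℂ] H)) := by
  have h1 : IsStrictlyPositive (ε • (1 : H →L[ℂ] H)) := by
    refine ⟨smul_nonneg hε.le zero_le_one, ?_⟩
    rw [← Algebra.algebraMap_eq_smul_one]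
    exact (isUnit_iff_ne_zero.2 hε.ne').map (algebraMap ℝ (H →L[ℂ] H))
  exact IsStrictlyPositive.nonneg_add hA h1

theorem smul_smul_le_smul_smul {S T : H →L[ℂ] H} {a b : ℝ} (ha : 0 ≤ a) (hb : 0 ≤ b)
    (h : S ≤ T) : b • a • S ≤ a • b • T := by
  rw [smul_comm a b]
  exact smul_le_smul_of_nonneg_left (smul_le_smul_of_nonneg_left h ha) hb

end OrderLemmas

section TwoByTwo

/-- The continuous functional calculus of a positive operator annihilated by a quadratic
polynomial with distinct roots is given by linear interpolation. -/
theorem smul_cfc_of_mul_eq_zero (f : ℝ≥0 → ℝ≥0) {A : H →L[ℂ] H} (hA : 0 ≤ A) (p q : ℝ≥0)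
    (h : (A - (p : ℝ) • (1 : H →L[ℂ] H)) * (A - (q : ℝ) • (1 : H →L[ℂ] H)) = 0) :
    ((q : ℝ) - p) • cfc f A
      = ((f q : ℝ) - f p) • A + ((q : ℝ) * f p - p * f q) • (1 : H →L[ℂ] H) := by
  have hsa : IsSelfAdjoint A := IsSelfAdjoint.of_nonneg hA
  have hspec : ∀ x ∈ spectrum ℝ A, x = p ∨ x = q := by
    have h1 : cfc (fun x : ℝ => (x - p) * (x - q)) A = cfc (fun _ : ℝ => (0 : ℝ)) A := by
      rw [cfc_mul (fun x : ℝ => x - p) (fun x : ℝ => x - q) A,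
        cfc_sub (fun x : ℝ => x) (fun _ : ℝ => (p : ℝ)) A,
        cfc_sub (fun x : ℝ => x) (fun _ : ℝ => (q : ℝ)) A, cfc_id' ℝ A, cfc_const _ A,
        cfc_const _ A, cfc_const _ A]
      simpa [Algebra.algebraMap_eq_smul_one] using h
    intro x hx
    have h2 := eqOn_of_cfc_eq_cfc h1 (by fun_prop) (by fun_prop) hsa hx
    simpa [sub_eq_zero] using h2
  have hfin : (spectrum ℝ A).Finite :=
    Set.Finite.subset (Set.toFinite {(p : ℝ), (q : ℝ)}) fun x hx => by simpa using hspec x hx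
  rw [cfc_nnreal_eq_real f A hA, ← cfc_smul _ _ A (hfin.continuousOn _)]
  have : ((f q : ℝ) - f p) • A + ((q : ℝ) * f p - p * f q) • (1 : H →L[ℂ] H)
      = cfc (fun x : ℝ => ((f q : ℝ) - f p) * x + ((q : ℝ) * f p - p * f q)) A := by
    rw [cfc_add A (fun x : ℝ => ((f q : ℝ) - f p) * x) (fun _ : ℝ => ((q : ℝ) * f p - p * f q)),
      cfc_const_mul _ (fun x : ℝ => x) A, cfc_id' ℝ A, cfc_const _ A,
      Algebra.algebraMap_eq_smul_one]
  rw [this]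
  refine cfc_congr fun x hx => ?_
  rcases hspec x hx with rfl | rfl <;> simp <;> ring

/-- Nonnegativity of third divided differences of an operator monotone function, in a form
cleared of denominators. -/
theorem OperatorMonotone.third_difference {f : ℝ≥0 → ℝ≥0} (hf : OperatorMonotone f)
    {p₁ m₁ p₂ m₂ : ℝ≥0} (h₁ : p₁ < m₁) (h₂ : m₁ < p₂) (h₃ : p₂ < m₂) :
    ((p₂ : ℝ) - m₁) * (m₂ - p₂) * (m₂ - m₁) * f p₁ + ((m₁ : ℝ) - p₁) * (m₂ - p₁) * (m₂ - m₁) * f p₂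
      ≤ ((f m₂ : ℝ) - f m₁) * (((p₂ : ℝ) - m₁) * (m₂ - p₂) * p₁ + ((m₁ : ℝ) - p₁) * (m₂ - p₁) * p₂)
        + ((m₂ : ℝ) * f m₁ - m₁ * f m₂) *
          (((p₂ : ℝ) - m₁) * (m₂ - p₂) + ((m₁ : ℝ) - p₁) * (m₂ - p₁)) := by
  have e1 : (p₁ : ℝ) < m₁ := by exact_mod_cast h₁
  have e2 : (m₁ : ℝ) < p₂ := by exact_mod_cast h₂
  have e3 : (p₂ : ℝ) < m₂ := by exact_mod_cast h₃
  set c : ℝ := p₂ - p₁ with hc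
  have hcpos : 0 < c := by simp only [hc]; linarith
  obtain ⟨v, hv⟩ : ∃ v : ℝ, v * v = (m₁ - p₁) * (m₂ - p₁) / c :=
    ⟨_, Real.mul_self_sqrt (div_nonneg (mul_nonneg (by linarith) (by linarith)) hcpos.le)⟩
  obtain ⟨u, hu⟩ : ∃ u : ℝ, u * u = (p₂ - m₁) * (m₂ - p₂) / c :=
    ⟨_, Real.mul_self_sqrt (div_nonneg (mul_nonneg (by linarith) (by linarith)) hcpos.le)⟩
  have hv' : v * v * c = (m₁ - p₁) * (m₂ - p₁) := by rw [hv]; field_simp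
  have hu' : u * u * c = (p₂ - m₁) * (m₂ - p₂) := by rw [hu]; field_simp
  have htr : v * v + u * u = m₁ + m₂ - p₁ - p₂ := by
    rw [hv, hu, ← add_div, div_eq_iff hcpos.ne', hc]; ring
  have hdet : p₁ * (u * u) + p₂ * (v * v) + p₁ * p₂ = m₁ * m₂ := by
    rw [hv, hu]; field_simp; rw [hc]; ring
  let Φ : Matrix (Fin 2) (Fin 2) ℂ ≃⋆ₐ[ℂ]
      (EuclideanSpace ℂ (Fin 2) →L[ℂ] EuclideanSpace ℂ (Fin 2)) :=
    Matrix.toEuclideanCLM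
  have hΦpos : ∀ N : Matrix (Fin 2) (Fin 2) ℂ, 0 ≤ Φ (star N * N) := fun N => by
    rw [map_mul, map_star]; exact star_mul_self_nonneg _
  have hΦsm : ∀ r : ℝ,
      r • (1 : EuclideanSpace ℂ (Fin 2) →L[ℂ] EuclideanSpace ℂ (Fin 2)) =
        Φ ((r : ℂ) • 1) := fun r => by
    rw [map_smul, map_one]; ext; simp
  set A : EuclideanSpace ℂ (Fin 2) →L[ℂ] EuclideanSpace ℂ (Fin 2) := Φ !![(p₁ : ℝ), 0; 0, (p₂ : ℝ)] with hAdef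
  set B : EuclideanSpace ℂ (Fin 2) →L[ℂ] EuclideanSpace ℂ (Fin 2) :=
    Φ !![((p₁ + v * v : ℝ) : ℂ), ((v * u : ℝ) : ℂ);
    ((v * u : ℝ) : ℂ), ((p₂ + u * u : ℝ) : ℂ)] with hBdef
  have hA : 0 ≤ A := by
    have : A = Φ (star !![((√p₁ : ℝ) : ℂ), 0; 0, ((√p₂ : ℝ) : ℂ)] *
        !![((√p₁ : ℝ) : ℂ), 0; 0, ((√p₂ : ℝ) : ℂ)]) := by
      rw [hAdef]
      congr 1
      ext i j
      fin_cases i <;> fin_cases j <;>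
        simp [Matrix.mul_apply, Fin.sum_univ_two, Matrix.star_apply, ← Complex.ofReal_mul]
    rw [this]; exact hΦpos _
  have hAB : A ≤ B := by
    have : B - A = Φ (star !![(v : ℂ), (u : ℂ); 0, 0] * !![(v : ℂ), (u : ℂ); 0, 0]) := by
      rw [hAdef, hBdef, ← map_sub]
      congr 1
      ext i j
      fin_cases i <;> fin_cases j <;>
        simp [Matrix.mul_apply, Fin.sum_univ_two, Matrix.star_apply, mul_comm]
    rw [← sub_nonneg, this]; exact hΦpos _
  have hB : 0 ≤ B := hA.trans hAB
  have hAeq :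
      (A - (p₁ : ℝ) • (1 : EuclideanSpace ℂ (Fin 2) →L[ℂ] EuclideanSpace ℂ (Fin 2))) *
      (A - (p₂ : ℝ) • (1 : EuclideanSpace ℂ (Fin 2) →L[ℂ] EuclideanSpace ℂ (Fin 2))) = 0 := by
    rw [hΦsm, hΦsm, hAdef, ← map_sub, ← map_sub, ← map_mul, ← map_zero Φ]
    congr 1
    ext i j
    fin_cases i <;> fin_cases j <;> simp [Matrix.mul_apply, Fin.sum_univ_two]
  have hBeq :
      (B - (m₁ : ℝ) • (1 : EuclideanSpace ℂ (Fin 2) →L[ℂ] EuclideanSpace ℂ (Fin 2))) *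
      (B - (m₂ : ℝ) • (1 : EuclideanSpace ℂ (Fin 2) →L[ℂ] EuclideanSpace ℂ (Fin 2))) = 0 := by
    rw [hΦsm, hΦsm, hBdef, ← map_sub, ← map_sub, ← map_mul, ← map_zero Φ]
    congr 1
    ext i j
    fin_cases i <;> fin_cases j <;>
      simp [Matrix.mul_apply, Fin.sum_univ_two] <;> norm_cast
    · linear_combination ((p₁ : ℝ) + v * v) * htr - hdet
    · linear_combination (v * u) * htr
    · linear_combination (v * u) * htr
    · linear_combination ((p₂ : ℝ) + u * u) * htr - hdet
  have hfA := smul_cfc_of_mul_eq_zero f hA p₁ p₂ hAeq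
  have hfB := smul_cfc_of_mul_eq_zero f hB m₁ m₂ hBeq
  have hle : cfc f A ≤ cfc f B :=
    hf _ A B ((nonneg_iff_isPositive A).1 hA) ((nonneg_iff_isPositive B).1 hB) hAB
  have hle' := smul_smul_le_smul_smul (sub_nonneg.2 (e1.trans e2).le)
    (sub_nonneg.2 (e2.trans e3).le) hle
  rw [hfA, hfB, ← sub_nonneg, nonneg_iff_isPositive] at hle'
  have hq := hle'.re_inner_nonneg_left (WithLp.toLp 2 ![(u : ℂ), (-v : ℂ)])
  have hAw : A (WithLp.toLp 2 ![(u : ℂ), (-v : ℂ)])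
      = WithLp.toLp 2 ![(p₁ * u : ℂ), (-(p₂ * v) : ℂ)] := by
    refine (Matrix.toEuclideanCLM_toLp _ _).trans (congrArg _ ?_)
    ext i
    fin_cases i <;> simp [Matrix.mulVec, dotProduct, Fin.sum_univ_two]
  have hBw : B (WithLp.toLp 2 ![(u : ℂ), (-v : ℂ)])
      = WithLp.toLp 2 ![(p₁ * u : ℂ), (-(p₂ * v) : ℂ)] := by
    refine (Matrix.toEuclideanCLM_toLp _ _).trans (congrArg _ ?_)
    ext i
    fin_cases i <;> simp [Matrix.mulVec, dotProduct, Fin.sum_univ_two] <;> ring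
  simp only [sub_apply, add_apply, smul_apply, hAw, hBw, one_apply_eq_self] at hq
  simp [PiLp.inner_apply, Fin.sum_univ_two] at hq
  rw [← hu', ← hv', hc]
  linear_combination hq

end TwoByTwo

section Connection

variable {σ : (H →L[ℂ] H) → (H →L[ℂ] H) → (H →L[ℂ] H)} {f : ℝ≥0 → ℝ≥0}

theorem IsConnection.mono_of_nonneg (hσ : IsConnection σ) {A B C D : H →L[ℂ] H} (hA : 0 ≤ A)
    (hB : 0 ≤ B) (hAC : A ≤ C) (hBD : B ≤ D) : σ A B ≤ σ C D :=
  hσ.mono A B C D ((nonneg_iff_isPositive A).1 hA) ((nonneg_iff_isPositive B).1 hB)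
    ((nonneg_iff_isPositive C).1 (hA.trans hAC)) ((nonneg_iff_isPositive D).1 (hB.trans hBD)) hAC hBD

theorem IsConnection.transformer_of_nonneg (hσ : IsConnection σ) {A B C : H →L[ℂ] H} (hA : 0 ≤ A)
    (hB : 0 ≤ B) (hC : 0 ≤ C) : C * σ A B * C ≤ σ (C * A * C) (C * B * C) :=
  hσ.transformer A B C ((nonneg_iff_isPositive A).1 hA) ((nonneg_iff_isPositive B).1 hB)
    ((nonneg_iff_isPositive C).1 hC)

theorem IsConnection.apply_smul_of_isStrictlyPositive (hσ : IsConnection σ)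
    (hf : IsRepresentingFunction σ f) {E : H →L[ℂ] H} (hE : IsStrictlyPositive E) (x : ℝ≥0) :
    σ E ((x : ℝ) • E) ≤ (f x : ℝ) • E := by
  have hE0 : 0 ≤ E := hE.nonneg
  set N : H →L[ℂ] H := E ^ (-(1 / 2) : ℝ) with hN
  set C : H →L[ℂ] H := E ^ (1 / 2 : ℝ) with hC
  have hNE : N * E * N = 1 := CFC.conjugate_rpow_neg_one_half E hE
  have hNC : N * C = 1 := CFC.rpow_neg_mul_rpow (1 / 2) hE
  have hCN : C * N = 1 := CFC.rpow_mul_rpow_neg (1 / 2) hE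
  have hCC : C * C = E := by
    rw [hC, ← CFC.rpow_add hE.isUnit]
    norm_num
    exact CFC.rpow_one E
  have hN0 : 0 ≤ N := CFC.rpow_nonneg
  have hC0 : 0 ≤ C := CFC.rpow_nonneg
  have h1 := hσ.transformer_of_nonneg hE0 (smul_nonneg x.2 hE0 : (0 : H →L[ℂ] H) ≤ (x : ℝ) • E) hN0
  rw [mul_smul_comm, smul_mul_assoc, hNE, hf.2 x] at h1
  have h2 := conjugate_le_conjugate_of_nonneg h1 hC0
  have e : C * (N * σ E ((x : ℝ) • E) * N) * C = (C * N) * σ E ((x : ℝ) • E) * (N * C) := by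
    simp only [mul_assoc]
  rw [e, hCN, hNC, one_mul, mul_one, mul_smul_comm, mul_one, smul_mul_assoc, hCC] at h2
  exact h2

/-- A connection maps `(D, x D)` to `f(x) D`, where `f` is its representing function. -/
theorem IsConnection.apply_smul (hσ : IsConnection σ) (hf : IsRepresentingFunction σ f)
    {D : H →L[ℂ] H} (hD : 0 ≤ D) (x : ℝ≥0) : σ D ((x : ℝ) • D) = (f x : ℝ) • D := by
  apply le_antisymm
  · refine le_of_forall_pos_le_add_smul (X := (f x : ℝ) • 1) fun ε hε => ?_
    have hle : D ≤ D + ε • (1 : H →L[ℂ] H) :=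
      le_add_of_nonneg_right (smul_nonneg hε.le zero_le_one)
    have h := hσ.mono_of_nonneg hD (smul_nonneg x.2 hD : (0 : H →L[ℂ] H) ≤ (x : ℝ) • D) hle
      (smul_le_smul_of_nonneg_left hle x.2)
    refine h.trans ((hσ.apply_smul_of_isStrictlyPositive hf
      (isStrictlyPositive_add_smul_one hD hε) x).trans_eq ?_)
    rw [smul_add, smul_comm]
  · have hC0 : 0 ≤ CFC.sqrt D := CFC.sqrt_nonneg D
    have h := hσ.transformer_of_nonneg zero_le_one
      (smul_nonneg x.2 zero_le_one : (0 : H →L[ℂ] H) ≤ (x : ℝ) • 1) hC0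
    rw [hf.2 x] at h
    simpa only [mul_smul_comm, smul_mul_assoc, mul_one, CFC.sqrt_mul_sqrt_self D hD] using h

theorem IsConnection.representing_one [Nontrivial H] (hmean : σ 1 1 = 1)
    (hf : IsRepresentingFunction σ f) : f 1 = 1 := by
  have h := hf.2 1
  rw [NNReal.coe_one, one_smul, hmean] at h
  have h1 : (1 : ℝ) • (1 : H →L[ℂ] H) = (f 1 : ℝ) • 1 := by rw [one_smul, ← h]
  have := smul_left_injective ℝ (one_ne_zero (α := H →L[ℂ] H)) h1
  exact_mod_cast this.symm

/-- `f(x) / x` is antitone. -/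
theorem IsConnection.mul_representing_le [Nontrivial H] (hσ : IsConnection σ)
    (hf : IsRepresentingFunction σ f) {x y : ℝ≥0} (hx : 0 < x) (hxy : x ≤ y) :
    (x : ℝ) * f y ≤ y * f x := by
  have hx' : (0 : ℝ) < x := hx
  have hxy' : (x : ℝ) ≤ y := hxy
  have hy' : (0 : ℝ) < y := hx'.trans_le hxy'
  have hD : (0 : H →L[ℂ] H) ≤ ((x : ℝ) / y) • 1 := smul_nonneg (by positivity) zero_le_one
  have hD1 : ((x : ℝ) / y) • (1 : H →L[ℂ] H) ≤ 1 := by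
    conv_rhs => rw [← one_smul ℝ (1 : H →L[ℂ] H)]
    exact smul_one_le_smul_one_iff.2 ((div_le_one hy').2 hxy')
  have h := hσ.mono_of_nonneg hD (smul_nonneg y.2 hD : (0 : H →L[ℂ] H) ≤ (y : ℝ) • _) hD1 le_rfl
  have e : (y : ℝ) • ((x : ℝ) / y) • (1 : H →L[ℂ] H) = (x : ℝ) • 1 := by
    rw [smul_smul]; congr 1; field_simp
  rw [hσ.apply_smul hf hD y, e, hf.2 x, smul_smul, smul_one_le_smul_one_iff] at h
  rw [mul_div_assoc', div_le_iff₀ hy'] at h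
  linarith

/-- The spectrum of a positive fixed point of `A ↦ I σ A` consists of `0` and fixed points
of the representing function. -/
theorem IsConnection.representing_eq_of_mem_spectrum [Nontrivial H] (hσ : IsConnection σ)
    (hf : IsRepresentingFunction σ f) {A : H →L[ℂ] H} (hA : 0 ≤ A) (hfix : σ 1 A = A) {s : ℝ≥0}
    (hs0 : 0 < s) (hs : (s : ℝ) ∈ spectrum ℝ A) : f s = s := by
  have hsa : IsSelfAdjoint A := IsSelfAdjoint.of_nonneg hA
  have hnn : ∀ y ∈ spectrum ℝ A, 0 ≤ y := fun y hy => spectrum_nonneg_of_nonneg hA hy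
  have hs0' : (0 : ℝ) < s := hs0
  have hlow : ∀ x : ℝ≥0, s < x → (s : ℝ) ≤ f x := by
    intro x hx
    have hx' : (s : ℝ) < x := hx
    set C : H →L[ℂ] H := cfc (fun y : ℝ => max (x - y) 0) A with hC
    have hC0 : 0 ≤ C := cfc_nonneg fun y _ => le_max_right _ _
    have hCC : C * 1 * C = cfc (fun y : ℝ => max (x - y) 0 * max (x - y) 0) A := by
      rw [mul_one, cfc_mul (fun y : ℝ => max (x - y) 0) (fun y : ℝ => max (x - y) 0) A]
    have hCAC : C * A * C = cfc (fun y : ℝ => max (x - y) 0 * y * max (x - y) 0) A := by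
      rw [cfc_mul (fun y : ℝ => max (x - y) 0 * y) (fun y : ℝ => max (x - y) 0) A,
        cfc_mul (fun y : ℝ => max (x - y) 0) (fun y : ℝ => y) A, cfc_id' ℝ A]
    have hCC0 : 0 ≤ C * 1 * C := by
      rw [hCC]; exact cfc_nonneg fun y _ => mul_self_nonneg _
    have hCAC0 : 0 ≤ C * A * C := by
      rw [hCAC]
      exact cfc_nonneg fun y hy => mul_nonneg (mul_nonneg (le_max_right _ _) (hnn y hy))
        (le_max_right _ _)
    have hle : C * A * C ≤ (x : ℝ) • (C * 1 * C) := by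
      rw [hCAC, hCC, ← cfc_smul _ _ A]
      refine (cfc_le_iff _ _ A).2 fun y _ => ?_
      rcases le_total (x : ℝ) y with h | h
      · simp [max_eq_right (sub_nonpos.2 h)]
      · rw [max_eq_left (sub_nonneg.2 h), smul_eq_mul]
        nlinarith [mul_self_nonneg ((x : ℝ) - y)]
    have h := (hσ.transformer_of_nonneg zero_le_one hA hC0).trans
      (hσ.mono_of_nonneg hCC0 hCAC0 le_rfl hle)
    rw [hfix, hσ.apply_smul hf hCC0, hCAC, hCC, ← cfc_smul _ _ A, cfc_le_iff _ _ A] at h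
    have h' := h s hs
    rw [max_eq_left (sub_nonneg.2 hx'.le), smul_eq_mul] at h'
    have : (0 : ℝ) < (x - s) * (x - s) := mul_pos (sub_pos.2 hx') (sub_pos.2 hx')
    nlinarith
  have hupp : ∀ t : ℝ≥0, t < s → (f t : ℝ) ≤ s := by
    intro t ht
    have ht' : (t : ℝ) < s := ht
    have hd : (0 : ℝ) < s - t := sub_pos.2 ht'
    set D : H →L[ℂ] H := cfc (fun y : ℝ => min (max (y - t) 0 / (s - t)) 1) A with hD
    have hcont : Continuous (fun y : ℝ => min (max (y - t) 0 / ((s : ℝ) - t)) 1) := by fun_prop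
    have hcont' : ∀ r : ℝ, Continuous (fun y : ℝ => r • min (max (y - t) 0 / ((s : ℝ) - t)) 1) :=
      fun r => hcont.const_smul r
    have hD0 : 0 ≤ D := cfc_nonneg fun y _ => le_min (by positivity) zero_le_one
    have hD1 : D ≤ 1 := cfc_le_one _ A fun y _ => min_le_right _ _
    have hDA : (t : ℝ) • D ≤ A := by
      conv_rhs => rw [← cfc_id' ℝ A]
      rw [hD, ← cfc_smul _ _ A hcont.continuousOn,
        cfc_le_iff _ _ A (hcont' _).continuousOn]
      intro y hy
      rw [smul_eq_mul]
      rcases le_total y t with h | h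
      · simpa [max_eq_right (sub_nonpos.2 h)] using hnn y hy
      · exact (mul_le_of_le_one_right t.2 (min_le_right _ _)).trans h
    have h := hσ.mono_of_nonneg hD0 (smul_nonneg t.2 hD0 : (0 : H →L[ℂ] H) ≤ (t : ℝ) • D) hD1 hDA
    rw [hfix, hσ.apply_smul hf hD0] at h
    conv_rhs at h => rw [← cfc_id' ℝ A]
    rw [hD, ← cfc_smul _ _ A hcont.continuousOn,
      cfc_le_iff _ _ A (hcont' _).continuousOn] at h
    have h' := h s hs
    simpa [max_eq_left hd.le, div_self hd.ne'] using h'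
  apply le_antisymm
  · have key : ∀ t : ℝ≥0, 0 < t → t < s → (t : ℝ) * f s ≤ s * s := fun t ht0 ht =>
      (hσ.mul_representing_le hf ht0 ht.le).trans (mul_le_mul_of_nonneg_left (hupp t ht) s.2)
    rw [← NNReal.coe_le_coe]
    by_contra! hlt
    have hF : (0 : ℝ) < f s := hs0'.trans hlt
    obtain ⟨r, hr1, hr2⟩ := exists_between
      (show (s : ℝ) * s / f s < s by rw [div_lt_iff₀ hF]; exact mul_lt_mul_of_pos_left hlt hs0')
    have hr0 : 0 < r := lt_of_le_of_lt (by positivity) hr1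
    have := key ⟨r, hr0.le⟩ hr0 hr2
    rw [div_lt_iff₀ hF] at hr1
    exact absurd this (not_le.2 hr1)
  · have key : ∀ x : ℝ≥0, s < x → (s : ℝ) * s ≤ x * f s := fun x hx =>
      (mul_le_mul_of_nonneg_left (hlow x hx) s.2).trans (hσ.mul_representing_le hf hs0 hx.le)
    rw [← NNReal.coe_le_coe]
    refine le_of_mul_le_mul_left ?_ hs0'
    have ht : Tendsto (fun x : ℝ≥0 => (x : ℝ) * f s) (𝓝[>] s) (𝓝 (s * f s)) :=
      ((NNReal.continuous_coe.mul continuous_const).tendsto s).mono_left nhdsWithin_le_nhds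
    exact ge_of_tendsto ht (eventually_nhdsWithin_of_forall fun x hx => key x hx)

/-- If the representing function fixes two distinct positive points, then it is the identity
on the positive half-line. -/
theorem IsConnection.representing_eq_self [Nontrivial H] (hσ : IsConnection σ)
    (hf : IsRepresentingFunction σ f) {a b : ℝ≥0} (ha : 0 < a) (hab : a < b) (hfa : f a = a)
    (hfb : f b = b) {x : ℝ≥0} (hx : 0 < x) : f x = x := by
  have hmid : ∀ y : ℝ≥0, a ≤ y → y ≤ b → f y = y := by
    intro y hay hyb
    have h1 := hσ.mul_representing_le hf ha hay
    have h2 := hσ.mul_representing_le hf (ha.trans_le hay) hyb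
    rw [hfa] at h1
    rw [hfb] at h2
    have ha' : (0 : ℝ) < a := ha
    have hb' : (0 : ℝ) < b := ha.trans hab
    exact le_antisymm (NNReal.coe_le_coe.1 (by nlinarith)) (NNReal.coe_le_coe.1 (by nlinarith))
  obtain ⟨c, hac, hcb⟩ := exists_between hab
  have hc := hmid c hac.le hcb.le
  rcases lt_or_ge x a with hxa | hxa
  · have h1 := hσ.mul_representing_le hf hx hxa.le
    have h3 := hf.1.third_difference hxa hac hcb
    rw [hfa, hfb, hc] at h3
    rw [hfa] at h1
    have ha' : (0 : ℝ) < a := ha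
    have hac' : (a : ℝ) < c := hac
    have hcb' : (c : ℝ) < b := hcb
    have hw : 0 < ((c : ℝ) - a) * (b - c) * (b - a) := by
      have := sub_pos.2 hac'; have := sub_pos.2 hcb'; have := sub_pos.2 (hac'.trans hcb')
      positivity
    refine le_antisymm (NNReal.coe_le_coe.1 ?_) (NNReal.coe_le_coe.1 (by nlinarith))
    refine le_of_mul_le_mul_left ?_ hw
    linear_combination h3
  rcases le_or_gt x b with hxb | hxb
  · exact hmid x hxa hxb
  · have h1 := hσ.mul_representing_le hf (ha.trans hab) hxb.le
    have h3 := hf.1.third_difference hac hcb hxb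
    rw [hfa, hfb, hc] at h3
    rw [hfb] at h1
    have hb' : (0 : ℝ) < b := ha.trans hab
    have hac' : (a : ℝ) < c := hac
    have hcb' : (c : ℝ) < b := hcb
    have hbx' : (b : ℝ) < x := hxb
    have hw : 0 < ((c : ℝ) - a) * (b - c) * (b - a) := by
      have := sub_pos.2 hac'; have := sub_pos.2 hcb'; have := sub_pos.2 (hac'.trans hcb')
      positivity
    refine le_antisymm (NNReal.coe_le_coe.1 (by nlinarith)) (NNReal.coe_le_coe.1 ?_)
    refine le_of_mul_le_mul_left ?_ hw
    linear_combination h3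

/-- A connection whose representing function is the identity on the positive half-line is
right-trivial. -/
theorem IsConnection.eq_right_of_representing_eq_self (hσ : IsConnection σ)
    (hf : IsRepresentingFunction σ f) (hid : ∀ x : ℝ≥0, 0 < x → f x = x) {A B : H →L[ℂ] H}
    (hA : 0 ≤ A) (hB : 0 ≤ B) : σ A B = B := by
  have hscale : ∀ D : H →L[ℂ] H, 0 ≤ D → ∀ r : ℝ, 0 < r → σ (r • D) D = D := by
    intro D hD r hr
    have h := hσ.apply_smul hf (smul_nonneg hr.le hD) ⟨r⁻¹, (inv_pos.2 hr).le⟩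
    rw [hid ⟨r⁻¹, _⟩ (show (0 : ℝ) < r⁻¹ from inv_pos.2 hr)] at h
    change σ (r • D) (r⁻¹ • r • D) = r⁻¹ • r • D at h
    rwa [smul_smul, inv_mul_cancel₀ hr.ne', one_smul] at h
  obtain ⟨M, hM, hAM⟩ := exists_pos_le_smul_one hA
  obtain ⟨L, hL, hBL⟩ := exists_pos_le_smul_one hB
  have hup : ∀ ε : ℝ, 0 < ε → σ A B ≤ B + ε • (1 : H →L[ℂ] H) := by
    intro ε hε
    have hε1 : (0 : H →L[ℂ] H) ≤ ε • 1 := smul_nonneg hε.le zero_le_one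
    have hle : A ≤ (M / ε) • (B + ε • (1 : H →L[ℂ] H)) := by
      rw [smul_add, smul_smul, div_mul_cancel₀ _ hε.ne']
      exact hAM.trans (le_add_of_nonneg_left (smul_nonneg (by positivity) hB))
    have h := hσ.mono_of_nonneg hA hB hle (le_add_of_nonneg_right hε1)
    rwa [hscale _ (add_nonneg hB hε1) _ (by positivity)] at h
  have hlow : ∀ ε : ℝ, 0 < ε → B ≤ σ (A + ε • (1 : H →L[ℂ] H)) B := by
    intro ε hε
    have hle : (ε / L) • B ≤ A + ε • (1 : H →L[ℂ] H) := by
      refine (smul_le_smul_of_nonneg_left hBL (by positivity : 0 ≤ ε / L)).trans ?_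
      rw [smul_smul, div_mul_cancel₀ _ hL.ne']
      exact le_add_of_nonneg_left hA
    have h := hσ.mono_of_nonneg (smul_nonneg (by positivity : 0 ≤ ε / L) hB) hB hle le_rfl
    rwa [hscale _ hB _ (by positivity)] at h
  refine le_antisymm (le_of_forall_pos_le_add_smul hup) ?_
  have hlim : SOTTendsto (fun n : ℕ => A + (1 / ((n : ℝ) + 1)) • (1 : H →L[ℂ] H)) A := by
    intro x
    have : Tendsto (fun n : ℕ => A x + (1 / ((n : ℝ) + 1)) • x) atTop (𝓝 (A x + (0 : ℝ) • x)) :=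
      tendsto_const_nhds.add (tendsto_one_div_add_atTop_nhds_zero_nat.smul_const x)
    simpa using this
  refine (hσ.contFromAbove _ (fun _ => B) A B (fun n => (nonneg_iff_isPositive _).1 ?_)
    (fun _ => (nonneg_iff_isPositive _).1 hB) ((nonneg_iff_isPositive _).1 hA)
    ((nonneg_iff_isPositive _).1 hB) ?_ antitone_const hlim fun _ => tendsto_const_nhds).2.ge
    fun n => hlow _ (by positivity)
  · exact add_nonneg hA (smul_nonneg (by positivity) zero_le_one)
  · intro m n hmn
    refine add_le_add_right (smul_le_smul_of_nonneg_right ?_ zero_le_one) _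
    exact one_div_le_one_div_of_le (by positivity) (by gcongr)

/-- A nonregular mean fixes every orthogonal projection. -/
theorem IsConnection.one_apply_of_isIdempotentElem (hσ : IsConnection σ)
    (hf : IsRepresentingFunction σ f) (h0 : f 0 = 0) (h1 : f 1 = 1) {P : H →L[ℂ] H} (hP : 0 ≤ P)
    (hPP : IsIdempotentElem P) : σ 1 P = P := by
  have hPP' : P * P = P := hPP
  have hPsa : IsSelfAdjoint P := IsSelfAdjoint.of_nonneg hP
  have hQQ : (1 - P) * (1 - P) = 1 - P := hPP.one_sub
  have hQsa : IsSelfAdjoint (1 - P) := (IsSelfAdjoint.one _).sub hPsa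
  have hQ : 0 ≤ 1 - P := by
    rw [← hQQ]; nth_rw 1 [← hQsa.star_eq]; exact star_mul_self_nonneg _
  have hσP : σ P P = P := by simpa [h1] using hσ.apply_smul hf hP 1
  have hσ0 : σ 1 0 = 0 := by simpa [h0] using hf.2 0
  have hT : 0 ≤ σ 1 P := (nonneg_iff_isPositive _).2
    (hσ.isPositive 1 P isPositive_one ((nonneg_iff_isPositive _).1 hP))
  have hge : P ≤ σ 1 P := by
    have := hσ.mono_of_nonneg hP hP (sub_nonneg.1 hQ) le_rfl
    rwa [hσP] at this
  have hPT : P * σ 1 P * P ≤ P := by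
    have := hσ.transformer_of_nonneg zero_le_one hP hP
    rwa [mul_one, hPP', hPP', hσP] at this
  have hQT : (1 - P) * σ 1 P * (1 - P) = 0 := by
    refine le_antisymm ?_ (hQsa.conjugate_nonneg hT)
    have h := hσ.transformer_of_nonneg zero_le_one hP hQ
    have e : (1 - P) * P * (1 - P) = 0 := by rw [sub_mul, one_mul, hPP', sub_self, zero_mul]
    rw [mul_one, hQQ, e] at h
    exact h.trans ((hσ.mono_of_nonneg hQ le_rfl (sub_le_self _ hP) le_rfl).trans_eq hσ0)
  set S := CFC.sqrt (σ 1 P) with hS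
  have hSS : S * S = σ 1 P := CFC.sqrt_mul_sqrt_self _ hT
  have hSsa : IsSelfAdjoint S := IsSelfAdjoint.of_nonneg (CFC.sqrt_nonneg _)
  have hSQ : S * (1 - P) = 0 := by
    rw [← CStarRing.star_mul_self_eq_zero_iff, star_mul, hSsa.star_eq, hQsa.star_eq, ← hQT, ← hSS]
    simp only [mul_assoc]
  have hTQ : σ 1 P * (1 - P) = 0 := by rw [← hSS, mul_assoc, hSQ, mul_zero]
  have hQT' : (1 - P) * σ 1 P = 0 := by
    have := congrArg star hTQ
    rwa [star_mul, hQsa.star_eq, (IsSelfAdjoint.of_nonneg hT).star_eq, star_zero] at this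
  have e1 : σ 1 P = σ 1 P * P := by rwa [mul_sub, mul_one, sub_eq_zero] at hTQ
  have e2 : σ 1 P = P * σ 1 P := by rwa [sub_mul, one_mul, sub_eq_zero] at hQT'
  refine le_antisymm ?_ hge
  calc σ 1 P = P * σ 1 P * P := by rw [← e2, ← e1]
    _ ≤ P := hPT

end Connection

theorem isIdempotentElem_of_spectrum_subset {A : H →L[ℂ] H} (hA : IsSelfAdjoint A)
    (h : ∀ x ∈ spectrum ℝ A, x = 0 ∨ x = 1) : IsIdempotentElem A := by
  have h1 : cfc (fun x : ℝ => x * x) A = cfc (fun x : ℝ => x) A :=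
    cfc_congr fun x hx => by rcases h x hx with rfl | rfl <;> simp
  rwa [cfc_mul (fun x : ℝ => x) (fun x : ℝ => x) A, cfc_id' ℝ A] at h1

/-- For a nontrivial mean `σ`, if `I σ A = A` then `A` is an
orthogonal projection; consequently `σ` is nonregular iff the fixed points of
`A ↦ I σ A` among positive operators are exactly the orthogonal projections. -/
theorem nontrivial_mean_fixed_points [Nontrivial H]
    (σ : (H →L[ℂ] H) → (H →L[ℂ] H) → (H →L[ℂ] H)) (hσ : IsConnection σ)
    (hmean : σ 1 1 = 1)
    (hleft : ¬ ∀ A B : H →L[ℂ] H, A.IsPositive → B.IsPositive → σ A B = A)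
    (hright : ¬ ∀ A B : H →L[ℂ] H, A.IsPositive → B.IsPositive → σ A B = B)
    (f : ℝ≥0 → ℝ≥0) (hf : IsRepresentingFunction σ f) :
    (∀ A : H →L[ℂ] H, A.IsPositive → σ 1 A = A → IsIdempotentElem A) ∧
    (f 0 = 0 ↔
      ∀ A : H →L[ℂ] H, A.IsPositive → (IsIdempotentElem A ↔ σ 1 A = A)) := by
  have h1 : f 1 = 1 := IsConnection.representing_one hmean hf
  have hproj : ∀ A : H →L[ℂ] H, A.IsPositive → σ 1 A = A → IsIdempotentElem A := by
    intro A hA hfix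
    have hA0 : 0 ≤ A := (nonneg_iff_isPositive A).2 hA
    refine isIdempotentElem_of_spectrum_subset (IsSelfAdjoint.of_nonneg hA0) fun x hx => ?_
    by_contra! hne
    have hx0 : 0 < x := lt_of_le_of_ne (spectrum_nonneg_of_nonneg hA0 hx) hne.1.symm
    lift x to ℝ≥0 using hx0.le
    have hx0' : 0 < x := hx0
    have hfx := hσ.representing_eq_of_mem_spectrum hf hA0 hfix hx0' hx
    have hx1 : x ≠ 1 := fun h => hne.2 (by simp [h])
    refine hright fun B C hB hC => hσ.eq_right_of_representing_eq_self hf (fun y hy => ?_)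
      ((nonneg_iff_isPositive B).2 hB) ((nonneg_iff_isPositive C).2 hC)
    rcases lt_or_gt_of_ne hx1 with hlt | hlt
    · exact hσ.representing_eq_self hf hx0' hlt hfx h1 hy
    · exact hσ.representing_eq_self hf zero_lt_one hlt h1 hfx hy
  refine ⟨hproj, fun h0 A hA => ⟨fun hAA => ?_, hproj A hA⟩, fun h => ?_⟩
  · exact hσ.one_apply_of_isIdempotentElem hf h0 h1 ((nonneg_iff_isPositive A).2 hA) hAA
  · have hz := (h 0 isPositive_zero).1 (mul_zero 0)
    have hf0 := hf.2 0
    rw [NNReal.coe_zero, zero_smul, hz] at hf0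
    simpa using hf0.symm

end
end

section
/- Let f : [0,∞) → [0,∞) be an operator monotone function with f(1) = 1 that is neither the constant function 1 nor the identity function. Then: (i) for 0 < x < 1, x < f(x) < 1; and (ii) for x > 1, 1 < f(x) < x. -/
open ContinuousLinearMap Filter Topology MeasureTheory
open scoped NNReal ENNReal

set_option synthInstance.maxHeartbeats 1000000
set_option maxHeartbeats 1000000

noncomputable section

variable {H : Type} [NormedAddCommGroup H] [InnerProductSpace ℂ H] [CompleteSpace H]

/-- Every increment `F x = g (c + x) - g c` with `0 ≤ c` satisfies, in a form free of divisions,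
`F (a !ₚ b) ≤ F a !ₚ F b`, where `a !ₚ b` is the weighted harmonic mean of `a` and `b`. -/
def HarmonicLe (g : ℝ → ℝ) : Prop :=
  ∀ c a b p : ℝ, 0 ≤ c → 0 < a → 0 < b → 0 ≤ p → p ≤ 1 →
    (g (c + a * b / (p * b + (1 - p) * a)) - g c) *
      (p * (g (c + b) - g c) + (1 - p) * (g (c + a) - g c)) ≤
    (g (c + a) - g c) * (g (c + b) - g c)

lemma HarmonicLe.antitone_slope {g : ℝ → ℝ}
    (hm : ∀ x y, 0 ≤ x → x ≤ y → g x ≤ g y)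
    (key : HarmonicLe g)
    {c t u : ℝ} (hc : 0 ≤ c) (ht : 0 < t) (htu : t ≤ u) :
    t * (g (c + u) - g c) ≤ u * (g (c + t) - g c) := by
  have hu : 0 < u := ht.trans_le htu
  have hFt : 0 ≤ g (c + t) - g c := sub_nonneg.2 (hm _ _ hc (by linarith))
  have hFu : 0 ≤ g (c + u) - g c := sub_nonneg.2 (hm _ _ hc (by linarith))
  rcases hFu.eq_or_lt with hz | hpos
  · rw [← hz]; simpa using mul_nonneg hu.le hFt
  suffices h : t / u ≤ (g (c + t) - g c) / (g (c + u) - g c) by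
    rw [div_le_div_iff₀ hu hpos] at h; linarith
  refine le_of_forall_lt_imp_le_of_dense fun p hp => ?_
  rcases le_or_gt p 0 with hp0 | hp0
  · exact hp0.trans (div_nonneg hFt hpos.le)
  have hpu : 0 < t - p * u := by rw [lt_div_iff₀ hu] at hp; linarith
  have hp1 : p < 1 := hp.trans_le ((div_le_one hu).2 htu)
  set b := (1 - p) * (u * t) / (t - p * u) with hb
  have hb0 : 0 < b := by have : 0 < 1 - p := by linarith
                         positivity
  have hub : u ≤ b := by
    rw [hb, le_div_iff₀ hpu]
    have : 0 ≤ u * p * (u - t) := by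
      have : 0 ≤ u - t := by linarith
      positivity
    nlinarith
  have hmid : t * b / (p * b + (1 - p) * t) = u := by
    have h1 : b * (t - p * u) = (1 - p) * (u * t) := by rw [hb]; field_simp
    have : 0 < 1 - p := by linarith
    rw [div_eq_iff (by positivity)]; linarith
  have := key c t b p hc ht hb0 hp0.le hp1.le
  rw [hmid] at this
  have hFb : 0 < g (c + b) - g c := by have := hm (c + u) (c + b) (by linarith) (by linarith); linarith
  rw [le_div_iff₀ hpos]
  have h2 : 0 ≤ (g (c + u) - g c) * ((1 - p) * (g (c + t) - g c)) :=
    mul_nonneg hpos.le (mul_nonneg (by linarith) hFt)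
  refine le_of_mul_le_mul_right ?_ hFb
  linarith

lemma HarmonicLe.eq_of_eq_of_lt {g : ℝ → ℝ}
    (hm : ∀ x y, 0 ≤ x → x ≤ y → g x ≤ g y)
    (key : HarmonicLe g)
    {a b : ℝ} (ha : 0 < a) (hab : a < b) (h : g a = g b) {x : ℝ} (hx : 0 < x) : g x = g a := by
  have hlarge : ∀ x, a ≤ x → g x = g a := by
    intro x hx
    refine le_antisymm ?_ (hm _ _ ha.le hx)
    rcases le_total x b with hxb | hxb
    · rw [h]; exact hm _ _ (by linarith) hxb
    have := HarmonicLe.antitone_slope hm key ha.le (sub_pos.2 hab) (sub_le_sub_right hxb a)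
    simp only [add_sub_cancel, h, sub_self, mul_zero] at this
    have h3 : 0 < b - a := by linarith
    have := nonpos_of_mul_nonpos_right this h3
    linarith
  rcases le_or_gt a x with hax | hax
  · exact hlarge x hax
  refine le_antisymm (hm _ _ hx.le hax.le) ?_
  have hd : 0 < 2 * a - x := by linarith
  have hp0 : 0 < x / (2 * a - x) := by positivity
  have hp1 : x / (2 * a - x) ≤ 1 := by rw [div_le_one hd]; linarith
  have := key 0 x (2 * a) _ le_rfl hx (by linarith) hp0.le hp1
  have hmid : x * (2 * a) / (x / (2 * a - x) * (2 * a) + (1 - x / (2 * a - x)) * x) = a := by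
    have : x / (2 * a - x) * (2 * a) + (1 - x / (2 * a - x)) * x = 2 * x := by
      field_simp; ring
    rw [this]; field_simp
  rw [hmid] at this
  simp only [zero_add, hlarge (2 * a) (by linarith)] at this
  set p := x / (2 * a - x)
  rcases (sub_nonneg.2 (hm 0 a le_rfl ha.le)).eq_or_lt with hM | hM
  · have := hm 0 x le_rfl hx.le
    linarith
  · have h4 : 0 ≤ ((g a - g 0) * p) * (g x - g a) := by linarith
    have := nonneg_of_mul_nonneg_right h4 (by positivity)
    linarith

lemma HarmonicLe.antitone_div_self {g : ℝ → ℝ} (h0 : ∀ x, 0 ≤ x → 0 ≤ g x)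
    (hm : ∀ x y, 0 ≤ x → x ≤ y → g x ≤ g y)
    (key : HarmonicLe g)
    {t u : ℝ} (ht : 0 < t) (htu : t ≤ u) :
    t * g u ≤ u * g t := by
  have := HarmonicLe.antitone_slope hm key le_rfl ht htu
  have h2 := mul_nonneg (sub_nonneg.2 htu) (h0 0 le_rfl)
  simp only [zero_add] at this
  linarith

lemma HarmonicLe.eq_self_of_two_fixed_points {g : ℝ → ℝ} (h0 : ∀ x, 0 ≤ x → 0 ≤ g x)
    (hm : ∀ x y, 0 ≤ x → x ≤ y → g x ≤ g y)
    (key : HarmonicLe g)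
    {a b : ℝ} (ha : 0 < a) (hab : a < b) (hga : g a = a) (hgb : g b = b)
    {x : ℝ} (hx : 0 ≤ x) : g x = x := by
  have hb : 0 < b := ha.trans hab
  have hsmall : ∀ x, 0 ≤ x → x < a → g x ≤ x := by
    intro x hx hxa
    have := HarmonicLe.antitone_slope hm key hx (sub_pos.2 hxa) (sub_le_sub_right hab.le x)
    simp only [add_sub_cancel, hga, hgb] at this
    nlinarith
  have hz : g 0 = 0 := le_antisymm (hsmall 0 le_rfl ha) (h0 0 le_rfl)
  rcases hx.eq_or_lt with rfl | hx0
  · exact hz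
  rcases lt_or_ge x a with hxa | hxa
  · refine le_antisymm (hsmall x hx hxa) ?_
    have := HarmonicLe.antitone_div_self h0 hm key hx0 hxa.le
    rw [hga] at this
    exact le_of_mul_le_mul_left (by linarith) ha
  have hle : g x ≤ x := by
    have := HarmonicLe.antitone_div_self h0 hm key ha hxa
    rw [hga] at this
    exact le_of_mul_le_mul_left (by linarith) ha
  refine le_antisymm hle ?_
  rcases le_or_gt x b with hxb | hxb
  · have := HarmonicLe.antitone_div_self h0 hm key hx0 hxb
    rw [hgb] at this
    exact le_of_mul_le_mul_left (by linarith) hb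
  have hxa' : 0 < x - a := by linarith
  have hp0 : 0 ≤ a * (x - b) / (b * (x - a)) := by
    have : 0 ≤ x - b := by linarith
    positivity
  have hp1 : a * (x - b) / (b * (x - a)) < 1 := by
    rw [div_lt_one (by positivity)]; nlinarith
  have := key 0 a x _ le_rfl ha hx0 hp0 hp1.le
  set p := a * (x - b) / (b * (x - a)) with hp
  have hpe : p * (b * (x - a)) = a * (x - b) := by rw [hp]; field_simp
  have hq : 0 < 1 - p := by linarith
  have hD : 0 < p * x + (1 - p) * a := by positivity
  have hmid : a * x / (p * x + (1 - p) * a) = b := by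
    rw [div_eq_iff hD.ne']; linarith
  rw [hmid] at this
  simp only [zero_add, hz, hga, hgb, sub_zero] at this
  have h5 : 0 ≤ (g x - x) * ((1 - p) * a) * a := by
    have h6 : b * (p * x + (1 - p) * a) = a * x := by linarith
    have h7 : (b * (p * g x + (1 - p) * a)) * (p * x + (1 - p) * a)
       ≤ a * g x * (p * x + (1 - p) * a) := mul_le_mul_of_nonneg_right this hD.le
    have h8 : (b * (p * g x + (1 - p) * a)) * (p * x + (1 - p) * a) = a * x * (p * g x + (1 - p) * a) := by
      rw [← h6]; ring
    nlinarith
  have h9 := nonneg_of_mul_nonneg_left (nonneg_of_mul_nonneg_left h5 ha) (by positivity)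
  linarith

section
variable {K : Type*} [NormedAddCommGroup K] [InnerProductSpace ℂ K] [CompleteSpace K]

lemma cfc_real_of_isStarProjection {P : K →L[ℂ] K} (hP : IsStarProjection P) (φ : ℝ → ℝ) :
    cfc φ P = φ 1 • P + φ 0 • (1 - P) := by
  have hs : spectrum ℝ P ⊆ {0, 1} := hP.isIdempotentElem.spectrum_subset ℝ
  have hsa : IsSelfAdjoint P := hP.isSelfAdjoint
  have h : cfc φ P = cfc (fun k : ℝ => φ 0 + (φ 1 - φ 0) * k) P := by
    refine cfc_congr fun k hk => ?_
    rcases hs hk with rfl | rfl <;> simp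
  rw [h, cfc_const_add (φ 0) (fun k => (φ 1 - φ 0) * k) P, cfc_const_mul_id _ P,
    Algebra.algebraMap_eq_smul_one]
  module

lemma isPositive_projection_combination {P : K →L[ℂ] K} (hP : IsStarProjection P) (x y : ℝ≥0) :
    ((x : ℝ) • P + (y : ℝ) • (1 - P)).IsPositive := by
  rw [← nonneg_iff_isPositive]
  exact add_nonneg (smul_nonneg x.2 hP.nonneg) (smul_nonneg y.2 hP.one_sub.nonneg)

lemma cfc_projection_combination {P : K →L[ℂ] K} (hP : IsStarProjection P)
    (f : ℝ≥0 → ℝ≥0) (x y : ℝ≥0) :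
    cfc f ((x : ℝ) • P + (y : ℝ) • (1 - P)) = (f x : ℝ) • P + (f y : ℝ) • (1 - P) := by
  have hpos := (nonneg_iff_isPositive _).2 (isPositive_projection_combination hP x y)
  have hfin : (spectrum ℝ P).Finite :=
    (Set.toFinite {0, 1}).subset (hP.isIdempotentElem.spectrum_subset ℝ)
  have hl : (x : ℝ) • P + (y : ℝ) • (1 - P) = cfc (fun k : ℝ => y + (x - y) * k) P := by
    rw [cfc_real_of_isStarProjection hP]; simp
  rw [cfc_nnreal_eq_real f _ hpos, hl, ← cfc_comp' (fun k : ℝ => (f k.toNNReal : ℝ))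
    (fun k : ℝ => y + (x - y) * k) P ((hfin.image _).continuousOn _) (by fun_prop)
    hP.isSelfAdjoint, cfc_real_of_isStarProjection hP]
  simp
end

lemma OperatorMonotone.monotone {f : ℝ≥0 → ℝ≥0} (hf : OperatorMonotone f) : Monotone f := by
  intro x y hxy
  have h1 : IsStarProjection (1 : ℂ →L[ℂ] ℂ) := .one _
  have := hf ℂ _ _ (isPositive_projection_combination h1 x 0)
    (isPositive_projection_combination h1 y 0) (by
      rw [← sub_nonneg]
      have : (0 : ℂ →L[ℂ] ℂ) ≤ ((y : ℝ) - x) • 1 :=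
        smul_nonneg (sub_nonneg.2 (by exact_mod_cast hxy)) h1.nonneg
      convert this using 1
      module)
  rw [cfc_projection_combination h1, cfc_projection_combination h1, ContinuousLinearMap.le_def] at this
  have := this.2 1
  simpa [reApplyInnerSelf] using this

open InnerProductSpace in
lemma OperatorMonotone.harmonicLe {f : ℝ≥0 → ℝ≥0} (hf : OperatorMonotone f) :
    HarmonicLe fun x => (f x.toNNReal : ℝ) := by
  intro c a b p hc ha hb hp hp1
  beta_reduce
  obtain ⟨α, hα, rfl⟩ : ∃ α : ℝ, 0 ≤ α ∧ α ^ 2 = p := ⟨√p, by positivity, Real.sq_sqrt hp⟩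
  obtain ⟨β, hβ, hαβ⟩ : ∃ β : ℝ, 0 ≤ β ∧ β ^ 2 = 1 - α ^ 2 :=
    ⟨√(1 - α ^ 2), by positivity, Real.sq_sqrt (by linarith)⟩
  rw [← hαβ]
  set D := α ^ 2 * b + β ^ 2 * a with hD
  have hD0 : 0 < D := by
    rcases hα.eq_or_lt with h | h
    · have : β ^ 2 = 1 := by rw [hαβ, ← h]; norm_num
      rw [hD, this]; positivity
    · positivity
  set t := a * b / D with ht
  have ht0 : 0 < t := by positivity
  let v : EuclideanSpace ℂ (Fin 2) := !₂[(α : ℂ), (β : ℂ)]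
  let e : EuclideanSpace ℂ (Fin 2) := !₂[0, 1]
  let z : EuclideanSpace ℂ (Fin 2) := !₂[((β * a : ℝ) : ℂ), ((-(α * b) : ℝ) : ℂ)]
  have hv : IsStarProjection (rankOne ℂ v v) := isStarProjection_rankOne_self (by
    simp [v, EuclideanSpace.norm_eq, hαβ])
  have he : IsStarProjection (rankOne ℂ e e) := isStarProjection_rankOne_self (by
    simp [e, EuclideanSpace.norm_eq])
  have hcoe : ∀ s, 0 ≤ s → ((s.toNNReal : ℝ≥0) : ℝ) = s := fun s hs => Real.coe_toNNReal s hs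
  have hle : ((c + t).toNNReal : ℝ) • rankOne ℂ v v + (c.toNNReal : ℝ) • (1 - rankOne ℂ v v) ≤
      ((c + b).toNNReal : ℝ) • rankOne ℂ e e + ((c + a).toNNReal : ℝ) • (1 - rankOne ℂ e e) := by
    rw [hcoe _ (by positivity), hcoe _ (by positivity), hcoe _ (by positivity),
      hcoe _ (by positivity), ← sub_nonneg]
    have h1 : (0 : EuclideanSpace ℂ (Fin 2) →L[ℂ] EuclideanSpace ℂ (Fin 2)) ≤
        D⁻¹ • rankOne ℂ z z :=
      smul_nonneg (by positivity) ((nonneg_iff_isPositive _).2 (isPositive_rankOne_self z))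
    have hDD : (D : ℂ) * (D : ℂ)⁻¹ = 1 := mul_inv_cancel₀ (by exact_mod_cast hD0.ne')
    have hDc : (D : ℂ) = α ^ 2 * b + β ^ 2 * a := by rw [hD]; push_cast; ring
    have htc : (t : ℂ) = a * b * (D : ℂ)⁻¹ := by rw [ht]; push_cast; ring
    convert h1 using 1
    ext w i
    fin_cases i
    · simp [v, e, z, PiLp.inner_apply, htc]
      linear_combination (-a * w 0) * hDD + (D : ℂ)⁻¹ * a * w 0 * hDc
    · simp [v, e, z, PiLp.inner_apply, htc]
      linear_combination (-b * w 1) * hDD + (D : ℂ)⁻¹ * b * w 1 * hDc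
  have key := hf _ _ _ (isPositive_projection_combination hv _ _)
    (isPositive_projection_combination he _ _) hle
  rw [cfc_projection_combination hv, cfc_projection_combination he, ContinuousLinearMap.le_def] at key
  have hA : (0 : ℝ) ≤ f (c + a).toNNReal - f c.toNNReal :=
    sub_nonneg.2 (by exact_mod_cast hf.monotone (Real.toNNReal_le_toNNReal (by linarith)))
  have hB : (0 : ℝ) ≤ f (c + b).toNNReal - f c.toNNReal :=
    sub_nonneg.2 (by exact_mod_cast hf.monotone (Real.toNNReal_le_toNNReal (by linarith)))
  generalize (f (c + t).toNNReal : ℝ) = T at *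
  generalize (f (c + a).toNNReal : ℝ) = A at *
  generalize (f (c + b).toNNReal : ℝ) = B at *
  generalize (f c.toNNReal : ℝ) = C at *
  have h2 := key.2 !₂[(((B - C) * α : ℝ) : ℂ), (((A - C) * β : ℝ) : ℂ)]
  simp [reApplyInnerSelf, v, e, PiLp.inner_apply] at h2
  set S := α ^ 2 * (B - C) + β ^ 2 * (A - C) with hS
  have h3 : (T - C) * S * S ≤ (A - C) * (B - C) * S := by
    rw [hS]
    linarith
  have hS0 : 0 ≤ S := by positivity
  rcases hS0.eq_or_lt with h | h
  · rw [← h]; simpa using mul_nonneg hA hB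
  · exact le_of_mul_le_mul_right h3 h

open InnerProductSpace in
lemma exists_positive_operator_spectrum {K : Type*} [NormedAddCommGroup K] [InnerProductSpace ℂ K]
    [CompleteSpace K] {e : ℕ → K} (he : Orthonormal ℂ e) :
    ∃ B : K →L[ℂ] K, B.IsPositive ∧ rankOne ℂ (e 0) (e 0) ≤ B ∧
      ∀ n : ℕ, (1 / 2 : ℝ≥0) ^ n ∈ spectrum ℝ≥0 B := by
  let F : ℕ → K →L[ℂ] K := fun n => ((1 / 2 : ℝ) ^ n) • rankOne ℂ (e n) (e n)
  have hF : Summable F := by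
    refine Summable.of_norm_bounded (g := fun n => (1 / 2 : ℝ) ^ n) summable_geometric_two
      fun n => ?_
    simp [F, norm_smul, he.1 n]
  have hF0 : ∀ n, 0 ≤ F n := fun n =>
    smul_nonneg (by positivity) ((nonneg_iff_isPositive _).2 (isPositive_rankOne_self _))
  refine ⟨∑' n, F n, ?_, ?_, fun n => ?_⟩
  · exact (nonneg_iff_isPositive _).1 (tsum_nonneg hF0)
  · have := hF.le_tsum 0 (fun n _ => hF0 n)
    simpa [F] using this
  · have happ : (∑' n, F n) (e n) = ((1 / 2 : ℝ≥0) ^ n) • e n := by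
      have h1 := (ContinuousLinearMap.apply ℂ K (e n)).hasSum hF.hasSum
      refine h1.unique ?_
      convert hasSum_single n ?_ using 1
      · simp [F, he.1 n, NNReal.smul_def]
      · intro m hm
        simp [F, he.2 hm]
    rw [spectrum.mem_iff]
    rintro ⟨u, hu⟩
    have h0 : (u : K →L[ℂ] K) (e n) = 0 := by
      rw [hu, sub_apply, happ, Algebra.algebraMap_eq_smul_one]
      simp [NNReal.smul_def]
    have h2 : ((↑u⁻¹ : K →L[ℂ] K) * (u : K →L[ℂ] K)) (e n) = 0 := by
      rw [mul_apply_eq_comp, h0, map_zero]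
    rw [Units.inv_mul, one_apply_eq_self] at h2
    simpa [h2] using he.1 n

lemma orthonormal_lp_single :
    Orthonormal ℂ (fun n : ℕ => (lp.single 2 n 1 : lp (fun _ : ℕ => ℂ) 2)) := by
  rw [orthonormal_iff_ite]
  intro i j
  simp only [lp.inner_single_left]
  rcases eq_or_ne i j with h | h
  · subst h; simp
  · simp [h, lp.single_apply]

open InnerProductSpace in
lemma OperatorMonotone.map_zero_eq_one_of_orthonormal {f : ℝ≥0 → ℝ≥0} (hf : OperatorMonotone f)
    (h : ∀ x, 0 < x → f x = 1) {K : Type} [NormedAddCommGroup K] [InnerProductSpace ℂ K]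
    [CompleteSpace K] {e : ℕ → K} (he : Orthonormal ℂ e) : f 0 = 1 := by
  obtain ⟨B, hB, hle, hs⟩ := exists_positive_operator_spectrum he
  by_cases hc : ContinuousOn f (spectrum ℝ≥0 B)
  · have hlim : Tendsto (fun n : ℕ => (1 / 2 : ℝ≥0) ^ n) atTop (𝓝 0) :=
      tendsto_pow_atTop_nhds_zero_of_lt_one (by simp) (by
        rw [← NNReal.coe_lt_coe]; norm_num)
    have h0 : (0 : ℝ≥0) ∈ spectrum ℝ≥0 B :=
      (ContinuousFunctionalCalculus.isCompact_spectrum B).isClosed.mem_of_tendsto hlim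
        (.of_forall hs)
    have h1 := (hc 0 h0).tendsto.comp
      (tendsto_nhdsWithin_iff.2 ⟨hlim, .of_forall hs⟩)
    refine tendsto_nhds_unique h1 (tendsto_const_nhds.congr fun n => (h _ ?_).symm)
    positivity
  · have hP : IsStarProjection (rankOne ℂ (e 0) (e 0)) :=
      isStarProjection_rankOne_self (he.1 0)
    have h1 := hf _ _ B (isPositive_projection_combination hP 1 0) hB (by simpa using hle)
    rw [cfc_projection_combination hP, cfc_apply_of_not_continuousOn B hc, h 1 one_pos,
      ContinuousLinearMap.le_def] at h1
    have h2 := h1.2 (e 0)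
    simp [reApplyInnerSelf, he.1 0] at h2
    norm_num at h2

lemma OperatorMonotone.map_zero_eq_one {f : ℝ≥0 → ℝ≥0} (hf : OperatorMonotone f)
    (h : ∀ x, 0 < x → f x = 1) : f 0 = 1 :=
  hf.map_zero_eq_one_of_orthonormal h orthonormal_lp_single

/-- If `f` is operator monotone with `f(1) = 1` and `f` is neither
the constant function `1` nor the identity, then `x < f(x) < 1` for `0 < x < 1` and
`1 < f(x) < x` for `x > 1`. -/
theorem operatorMonotone_between (f : ℝ≥0 → ℝ≥0) (hf : OperatorMonotone f)
    (h1 : f 1 = 1) (hc : ¬ ∀ x, f x = 1) (hid : ¬ ∀ x, f x = x) :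
    (∀ x : ℝ≥0, 0 < x → x < 1 → x < f x ∧ f x < 1) ∧
    (∀ x : ℝ≥0, 1 < x → 1 < f x ∧ f x < x) := by
  set g : ℝ → ℝ := fun x => (f x.toNNReal : ℝ) with hg
  have hgf : ∀ x : ℝ≥0, g x = f x := fun x => by simp [hg]
  have key : HarmonicLe g := hf.harmonicLe
  have h0 : ∀ x, 0 ≤ x → 0 ≤ g x := fun x _ => NNReal.coe_nonneg _
  have hm : ∀ x y, 0 ≤ x → x ≤ y → g x ≤ g y := fun x y _ hxy =>
    NNReal.coe_le_coe.2 (hf.monotone (Real.toNNReal_le_toNNReal hxy))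
  have hg1 : g 1 = 1 := by simp [hg, h1]
  have hne1 : ∀ a b : ℝ≥0, 0 < a → a < b → f a = f b → f 1 = f a → False := by
    intro a b ha hab hfab hfa
    have hpos : ∀ x, 0 < x → f x = 1 := by
      intro x hx
      have := HarmonicLe.eq_of_eq_of_lt hm key (a := a) (b := b) (by exact_mod_cast ha)
        (by exact_mod_cast hab) (by rw [hgf, hgf, hfab]) (x := x) (by exact_mod_cast hx)
      rw [hgf, hgf] at this
      rw [← h1, hfa]
      exact_mod_cast this
    refine hc fun x => ?_
    rcases eq_zero_or_pos x with rfl | hx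
    · exact hf.map_zero_eq_one hpos
    · exact hpos x hx
  have hneid : ∀ a b : ℝ≥0, 0 < a → a < b → f a = a → f b = b → False := by
    intro a b ha hab hfa hfb
    refine hid fun x => ?_
    have := HarmonicLe.eq_self_of_two_fixed_points h0 hm key (a := a) (b := b)
      (by exact_mod_cast ha) (by exact_mod_cast hab) (by rw [hgf, hfa]) (by rw [hgf, hfb])
      (x := x) x.2
    rw [hgf] at this
    exact_mod_cast this
  refine ⟨fun x hx hx1 => ⟨lt_of_le_of_ne ?_ fun h => hneid x 1 hx hx1 h.symm h1,
    lt_of_le_of_ne (h1 ▸ hf.monotone hx1.le) fun h => hne1 x 1 hx hx1 (h.trans h1.symm)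
      (h1.trans h.symm)⟩, fun x hx => ⟨lt_of_le_of_ne (h1 ▸ hf.monotone hx.le)
      fun h => hne1 1 x one_pos hx (h1.trans h) rfl,
    lt_of_le_of_ne ?_ fun h => hneid 1 x one_pos hx h1 h⟩⟩
  · have := HarmonicLe.antitone_div_self h0 hm key (t := x) (u := 1) (by exact_mod_cast hx)
      (by exact_mod_cast hx1.le)
    rw [hg1, hgf, mul_one, one_mul] at this
    exact_mod_cast this
  · have := HarmonicLe.antitone_div_self h0 hm key (t := 1) (u := x) one_pos
      (by exact_mod_cast hx.le)
    rw [hg1, hgf, mul_one, one_mul] at this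
    exact_mod_cast this

end
end
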